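/- Let (Ω, Σ, μ) be a probability space, let 0 < p < 1, let S be a linear subspace of L^∞(μ), let S_1 be the closure of S in L^1(μ) and S_p the closure of S in L^p(μ), and let i_{1,p} : S_1 → S_p denote the natural inclusion (induced by the inclusion L^1(μ) ⊆ L^p(μ)). If E is a Banach space and T̃ : S_p → E is a continuous linear operator, then the composition T̃ ∘ i_{1,p} : S_1 → E is a weakly compact operator. -/

import Mathlib

open MeasureTheory ENNReal Filter Topology

theorem aux_regular {X : Type*} [TopologicalSpace X] [RegularSpace X] {s : Set X}
    (h : ∀ V : Ultrafilter X, s ∈ V → ∃ y, (V : Filter X) ≤ 𝓝 y) : IsCompact (closure s) := by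
  rw [isCompact_iff_ultrafilter_le_nhds']
  intro W hW
  let G : Filter X := (⨅ U ∈ {U : Set X | IsOpen U ∧ U ∈ W}, 𝓟 U) ⊓ 𝓟 s
  have hb : (⨅ U ∈ {U : Set X | IsOpen U ∧ U ∈ W}, 𝓟 U).HasBasis
      (fun U : Set X => U ∈ {U : Set X | IsOpen U ∧ U ∈ W}) id := by
    refine hasBasis_biInf_principal ?_ ⟨Set.univ, isOpen_univ, univ_mem⟩
    rintro a ⟨ha, ha'⟩ b ⟨hb, hb'⟩
    exact ⟨a ∩ b, ⟨ha.inter hb, inter_mem ha' hb'⟩, by simp, by simp⟩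
  have hG : G.NeBot := by
    refine (hb.inf_principal s).neBot_iff.2 ?_
    rintro U ⟨hU, hUW⟩
    obtain ⟨x, hxU, hxs⟩ := W.nonempty_of_mem (inter_mem hUW hW)
    exact mem_closure_iff.1 hxs U hU hxU
  obtain ⟨V, hV⟩ := Ultrafilter.exists_le G
  have hVs : s ∈ V := hV (mem_inf_of_right (mem_principal_self s))
  obtain ⟨y, hy⟩ := h V hVs
  refine ⟨y, ?_, ?_⟩
  · exact mem_closure_iff_ultrafilter.2 ⟨V, hVs, hy⟩
  · intro N hN
    obtain ⟨C, hC, hCc, hCN⟩ := exists_mem_nhds_isClosed_subset hN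
    refine mem_of_superset ?_ hCN
    by_contra hCW
    have : Cᶜ ∈ W := Ultrafilter.compl_mem_iff_notMem.2 hCW
    have h2 : Cᶜ ∈ V := hV (mem_inf_of_left (hb.mem_of_mem ⟨hCc.isOpen_compl, this⟩))
    exact Ultrafilter.compl_mem_iff_notMem.1 h2 (hy hC)

theorem aux_hilbert {H : Type*} [NormedAddCommGroup H] [InnerProductSpace ℂ H] [CompleteSpace H]
    {ι : Type*} (V : Ultrafilter ι) (v : ι → H) (R : ℝ) (hv : ∀ i, ‖v i‖ ≤ R) :
    ∃ h : H, ∀ A ∈ V, ∀ N : ℕ, ∃ i : ℕ → ι, (∀ k, i k ∈ A) ∧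
      ‖∑ k ∈ Finset.range N, (v (i k) - h)‖ ^ 2 ≤ N * (1 + (2 * R) ^ 2) := by
  let Φ : ι → WeakDual ℂ H := fun i => StrongDual.toWeakDual (InnerProductSpace.toDual ℂ H (v i))
  have hc := WeakDual.isCompact_closedBall (𝕜 := ℂ) (E := H) 0 R
  obtain ⟨ℓ, hℓ, hlim⟩ := hc.ultrafilter_le_nhds' (V.map Φ) (by
    refine mem_map.2 (Eventually.of_forall fun i => ?_)
    simpa [Φ] using hv i)
  let h : H := (InnerProductSpace.toDual ℂ H).symm (WeakDual.toStrongDual ℓ)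
  have hh : ‖h‖ ≤ R := by
    simpa [h] using hℓ
  have hw : ∀ w : H, Tendsto (fun i => inner ℂ (v i - h) w) V (𝓝 0) := by
    intro w
    have h1 : Tendsto (fun i => Φ i w) V (𝓝 (ℓ w)) :=
      ((WeakDual.eval_continuous w).tendsto ℓ).comp (show Tendsto Φ V (𝓝 ℓ) from hlim)
    have h2 : ∀ i, inner ℂ (v i - h) w = Φ i w - ℓ w := by
      intro i
      rw [inner_sub_left]
      simp [Φ, h, InnerProductSpace.toDual_symm_apply]
    simp only [h2]
    simpa using h1.sub_const (ℓ w)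
  refine ⟨h, fun A hA N => ?_⟩
  induction N with
  | zero =>
    obtain ⟨a, ha⟩ := V.nonempty_of_mem hA
    exact ⟨fun _ => a, fun _ => ha, by simp⟩
  | succ N ih =>
    obtain ⟨i, hi, hs⟩ := ih
    set s := ∑ k ∈ Finset.range N, (v (i k) - h) with hsdef
    have he : ∀ᶠ j in (V : Filter ι), ‖inner ℂ (v j - h) s‖ < 1 / 2 := by
      have := (hw s).norm
      rw [norm_zero] at this
      exact this.eventually (gt_mem_nhds (by norm_num))
    obtain ⟨j, hj, hjA⟩ := (he.and hA).exists
    refine ⟨fun k => if k < N then i k else j, fun k => ?_, ?_⟩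
    · dsimp only
      split_ifs
      exacts [hi k, hjA]
    · have e : ∑ k ∈ Finset.range (N + 1), (v (if k < N then i k else j) - h)
          = (v j - h) + s := by
        rw [Finset.sum_range_succ, if_neg (lt_irrefl N), add_comm]
        congr 1
        refine Finset.sum_congr rfl fun k hk => ?_
        rw [if_pos (Finset.mem_range.1 hk)]
      rw [e, norm_add_sq (𝕜 := ℂ)]
      have h1 : RCLike.re (inner ℂ (v j - h) s) ≤ 1 / 2 :=
        (RCLike.re_le_norm _).trans hj.le
      have h2 : ‖v j - h‖ ^ 2 ≤ (2 * R) ^ 2 := by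
        gcongr
        have := norm_sub_le (v j) h
        linarith [hv j]
      push_cast
      linarith

/-- truncation -/
noncomputable def auxT {Ω : Type*} (M : ℝ) (f : Ω → ℂ) : Ω → ℂ := {x | ‖f x‖ ≤ M}.indicator f

theorem auxT_norm_le {Ω : Type*} {M : ℝ} (hM : 0 ≤ M) (f : Ω → ℂ) (x : Ω) : ‖auxT M f x‖ ≤ M := by
  unfold auxT
  by_cases h : ‖f x‖ ≤ M
  · rw [Set.indicator_of_mem (by exact h)]; exact h
  · rw [Set.indicator_of_notMem (by exact h)]; simpa using hM

theorem auxT_sm {Ω : Type*} [MeasurableSpace Ω] (M : ℝ) {f : Ω → ℂ} (hf : StronglyMeasurable f) :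
    StronglyMeasurable (auxT M f) :=
  hf.indicator (measurableSet_le hf.norm.measurable measurable_const)

theorem auxT_sub_norm {Ω : Type*} {M M' : ℝ} (h : M ≤ M') (f : Ω → ℂ) (x : Ω) :
    ‖auxT M' f x - auxT M f x‖ = ‖auxT M' f x‖ - ‖auxT M f x‖ := by
  by_cases h1 : ‖f x‖ ≤ M
  · have h2 : ‖f x‖ ≤ M' := h1.trans h
    have e1 : auxT M f x = f x := Set.indicator_of_mem (by exact h1) _
    have e2 : auxT M' f x = f x := Set.indicator_of_mem (by exact h2) _
    simp [e1, e2]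
  · have e1 : auxT M f x = 0 := Set.indicator_of_notMem (by exact h1) _
    simp [e1]

theorem auxT_norm_le_self {Ω : Type*} (M : ℝ) (f : Ω → ℂ) (x : Ω) : ‖auxT M f x‖ ≤ ‖f x‖ := by
  unfold auxT
  exact norm_indicator_le_norm_self _ _

theorem aux_level {Ω : Type*} [MeasurableSpace Ω] {μ : Measure Ω} [IsProbabilityMeasure μ]
    {ι : Type*} (V : Ultrafilter ι) (f : ι → Ω → ℂ) (hf : ∀ i, StronglyMeasurable (f i))
    (hb : ∀ i, eLpNorm (f i) 1 μ ≤ 1) (ε : ℝ) (hε : 0 < ε) :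
    ∃ M : ℕ, ∀ M' : ℕ, M ≤ M' →
      ∀ᶠ i in (V : Filter ι), eLpNorm (auxT M' (f i) - auxT M (f i)) 1 μ ≤ ENNReal.ofReal ε := by
  have hint : ∀ (M : ℕ) i, Integrable (auxT M (f i)) μ := fun M i =>
    ((memLp_top_of_bound (auxT_sm _ (hf i)).aestronglyMeasurable M
      (Eventually.of_forall fun x => auxT_norm_le M.cast_nonneg _ x)).mono_exponent le_top :
        MemLp _ 1 μ).integrable le_rfl
  have hfint : ∀ i, Integrable (f i) μ := fun i =>
    memLp_one_iff_integrable.1 ⟨(hf i).aestronglyMeasurable, (hb i).trans_lt one_lt_top⟩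
  let I : ℕ → ι → ℝ := fun M i => ∫ x, ‖auxT M (f i) x‖ ∂μ
  have hI : ∀ M i, I M i ∈ Set.Icc (0 : ℝ) 1 := by
    intro M i
    refine ⟨integral_nonneg fun x => norm_nonneg _, ?_⟩
    have h1 : I M i ≤ ∫ x, ‖f i x‖ ∂μ :=
      integral_mono (hint M i).norm (hfint i).norm fun x => auxT_norm_le_self _ _ x
    refine h1.trans ?_
    rw [integral_norm_eq_lintegral_enorm (hf i).aestronglyMeasurable, ← eLpNorm_one_eq_lintegral_enorm]
    exact ENNReal.toReal_le_of_le_ofReal zero_le_one (by simpa using hb i)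
  have hlim : ∀ M, ∃ a ∈ Set.Icc (0 : ℝ) 1, Tendsto (I M) V (𝓝 a) := fun M =>
    isCompact_Icc.ultrafilter_le_nhds' (V.map (I M)) (mem_map.2 (Eventually.of_forall (hI M)))
  choose a ha hat using hlim
  have hbdd : BddAbove (Set.range a) := ⟨1, by rintro _ ⟨M, rfl⟩; exact (ha M).2⟩
  obtain ⟨M, hM⟩ := exists_lt_of_lt_ciSup (show (⨆ M, a M) - ε / 4 < ⨆ M, a M by linarith)
  refine ⟨M, fun M' hMM' => ?_⟩
  have h1 := (hat M).eventually (lt_mem_nhds (show a M - ε / 4 < a M by linarith))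
  have h2 := (hat M').eventually (gt_mem_nhds (show a M' < a M' + ε / 4 by linarith))
  have h3 : a M' ≤ ⨆ M, a M := le_ciSup hbdd M'
  filter_upwards [h1, h2] with i h1 h2
  rw [eLpNorm_one_eq_lintegral_enorm, ← ofReal_integral_norm_eq_lintegral_enorm ((hint M' i).sub (hint M i))]
  refine ENNReal.ofReal_le_ofReal ?_
  have : ∫ x, ‖(auxT M' (f i) - auxT M (f i)) x‖ ∂μ = I M' i - I M i := by
    rw [← integral_sub (hint M' i).norm (hint M i).norm]
    refine integral_congr_ae (Eventually.of_forall fun x => ?_)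
    exact auxT_sub_norm (by exact_mod_cast hMM') _ _
  rw [this]
  linarith

theorem aux_avg {Ω : Type*} [MeasurableSpace Ω] {μ : Measure Ω} {N : ℕ} (hN : 0 < N)
    (g : ℕ → Ω → ℂ) (hg : ∀ k, AEStronglyMeasurable (g k) μ) (c : ℝ≥0∞)
    (hc : ∀ k, eLpNorm (g k) 1 μ ≤ c) :
    eLpNorm ((N : ℂ)⁻¹ • ∑ k ∈ Finset.range N, g k) 1 μ ≤ c := by
  rw [eLpNorm_const_smul]
  have h1 : eLpNorm (∑ k ∈ Finset.range N, g k) 1 μ ≤ N * c := by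
    refine (eLpNorm_sum_le (fun k _ => hg k) le_rfl).trans ?_
    refine (Finset.sum_le_sum fun k _ => hc k).trans ?_
    simp
  have hN' : (N : ℂ) ≠ 0 := by exact_mod_cast hN.ne'
  have h2 : ‖(N : ℂ)⁻¹‖ₑ = (N : ℝ≥0∞)⁻¹ := by
    rw [enorm_inv hN']
    congr 1
    rw [← ofReal_norm]; simp
  rw [h2]
  calc (N : ℝ≥0∞)⁻¹ * _ ≤ (N : ℝ≥0∞)⁻¹ * (N * c) := by gcongr
    _ = c := by
      rw [← mul_assoc, ENNReal.inv_mul_cancel (by exact_mod_cast hN.ne') (by simp), one_mul]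

theorem aux_coe_sum {Ω : Type*} [MeasurableSpace Ω] {μ : Measure Ω}
    (g : ℕ → Ω → ℂ) (hg : ∀ k, MemLp (g k) 2 μ) (h : Lp ℂ 2 μ) (N : ℕ) :
    (⇑(∑ k ∈ Finset.range N, ((hg k).toLp (g k) - h)) : Ω → ℂ) =ᵐ[μ]
      ∑ k ∈ Finset.range N, (g k - ⇑h) := by
  induction N with
  | zero => simpa using Lp.coeFn_zero ℂ 2 μ
  | succ N ih =>
    rw [Finset.sum_range_succ, Finset.sum_range_succ]
    exact (Lp.coeFn_add _ _).trans
      (ih.add ((Lp.coeFn_sub _ _).trans ((hg N).coeFn_toLp.sub (EventuallyEq.refl _ _))))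

theorem aux_small {Ω : Type*} [MeasurableSpace Ω] {μ : Measure Ω} {p : ℝ≥0∞} (hp1 : p < 1)
    (g : Ω → ℂ) (hg : AEStronglyMeasurable g μ) (h1 : eLpNorm g 1 μ ≤ 1) (D : Set Ω)
    (hD : MeasurableSet D) (hgD : ∀ x ∉ D, g x = 0) :
    eLpNorm g p μ ≤ (μ D) ^ (1 / p.toReal - 1) := by
  have e : D.indicator g = g := by
    ext x
    by_cases hx : x ∈ D
    · simp [hx]
    · simp [hx, hgD x hx]
  have e2 := eLpNorm_indicator_eq_eLpNorm_restrict (f := g) (p := p) (μ := μ) hD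
  rw [e] at e2
  rw [e2]
  refine (eLpNorm_le_eLpNorm_mul_rpow_measure_univ hp1.le hg.restrict).trans ?_
  have h3 : eLpNorm g 1 (μ.restrict D) ≤ 1 :=
    (eLpNorm_mono_measure g Measure.restrict_le_self).trans h1
  simp only [Measure.restrict_apply_univ, ENNReal.toReal_one, div_one]
  calc _ ≤ 1 * μ D ^ (1 / p.toReal - 1) := by gcongr
    _ = _ := one_mul _

theorem aux_key {Ω : Type*} [MeasurableSpace Ω] {μ : Measure Ω} [IsProbabilityMeasure μ]
    {p : ℝ≥0∞} (hp0 : 0 < p) (hp1 : p < 1)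
    {ι : Type*} (V : Ultrafilter ι) (f : ι → Ω → ℂ) (hf : ∀ i, StronglyMeasurable (f i))
    (hb : ∀ i, eLpNorm (f i) 1 μ ≤ 1) (η : ℝ) (hη : 0 < η) :
    ∃ h : Ω → ℂ, AEStronglyMeasurable h μ ∧ ∀ A ∈ V, ∃ N : ℕ, 0 < N ∧ ∃ i : ℕ → ι,
      (∀ k, i k ∈ A) ∧ eLpNorm ((N : ℂ)⁻¹ • ∑ k ∈ Finset.range N, f (i k) - h) p μ ≤
        LpAddConst p * (LpAddConst p * (ENNReal.ofReal η + ENNReal.ofReal η) + ENNReal.ofReal η) := by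
  obtain ⟨M, hM⟩ := aux_level (μ := μ) V f hf hb η hη
  have hmem : ∀ i, MemLp (auxT M (f i)) 2 μ := fun i =>
    (memLp_top_of_bound (auxT_sm _ (hf i)).aestronglyMeasurable M
      (Eventually.of_forall fun x => auxT_norm_le M.cast_nonneg _ x)).mono_exponent le_top
  obtain ⟨h, hh⟩ := aux_hilbert V (fun i => (hmem i).toLp (auxT M (f i))) M (fun i => by
    have := Lp.norm_le_of_ae_bound (f := (hmem i).toLp (auxT M (f i))) (M.cast_nonneg) (by
      filter_upwards [(hmem i).coeFn_toLp] with x hx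
      rw [hx]
      exact auxT_norm_le M.cast_nonneg _ x)
    simpa [measureUnivNNReal] using this)
  refine ⟨h, (Lp.aestronglyMeasurable h), fun A hA => ?_⟩
  obtain ⟨N, hN⟩ := exists_nat_gt ((1 + (2 * (M : ℝ)) ^ 2) / η ^ 2)
  have hN0' : (0 : ℝ) < N := lt_of_le_of_lt (by positivity) hN
  have hN0 : 0 < N := by exact_mod_cast hN0'
  have hpt : 0 < p.toReal := ENNReal.toReal_pos hp0.ne' (hp1.trans one_lt_top).ne
  have hpt1 : p.toReal < 1 := by
    have := (ENNReal.toReal_lt_toReal (hp1.trans one_lt_top).ne one_ne_top).2 hp1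
    simpa using this
  set r : ℝ := 1 / p.toReal - 1 with hr
  have hr0 : 0 < r := by
    rw [hr, sub_pos]; exact (one_lt_div hpt).2 hpt1
  set τ : ℝ := η ^ (1 / r) with hτ
  have hτ0 : 0 < τ := Real.rpow_pos_of_pos hη _
  obtain ⟨m, hm⟩ := exists_nat_gt ((N : ℝ) / τ)
  have hm0 : (0 : ℝ) < m := lt_of_le_of_lt (by positivity) hm
  set M' : ℕ := max M m with hM'
  have hmM' : (m : ℝ) ≤ M' := by exact_mod_cast le_max_right M m
  have hM'0 : (0 : ℝ) < M' := hm0.trans_le hmM'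
  obtain ⟨i, hi, hsum⟩ := hh _ (inter_mem hA (hM M' (le_max_left _ _))) N
  refine ⟨N, hN0, i, fun k => (hi k).1, ?_⟩
  set G1 : Ω → ℂ := (N : ℂ)⁻¹ • ∑ k ∈ Finset.range N, (auxT M (f (i k)) - ⇑h) with hG1
  set G2 : Ω → ℂ := (N : ℂ)⁻¹ • ∑ k ∈ Finset.range N, (auxT M' (f (i k)) - auxT M (f (i k))) with hG2
  set G3 : Ω → ℂ := (N : ℂ)⁻¹ • ∑ k ∈ Finset.range N, (f (i k) - auxT M' (f (i k))) with hG3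
  have hNC : (N : ℂ) ≠ 0 := by exact_mod_cast hN0.ne'
  have hdec : (N : ℂ)⁻¹ • ∑ k ∈ Finset.range N, f (i k) - ⇑h = G1 + G2 + G3 := by
    rw [hG1, hG2, hG3, ← smul_add, ← smul_add, ← Finset.sum_add_distrib, ← Finset.sum_add_distrib]
    have : ∀ k, auxT M (f (i k)) - ⇑h + (auxT M' (f (i k)) - auxT M (f (i k))) +
        (f (i k) - auxT M' (f (i k))) = f (i k) - ⇑h := fun k => by abel
    simp only [this]
    rw [Finset.sum_sub_distrib, smul_sub]
    congr 1
    rw [Finset.sum_const, Finset.card_range, ← Nat.cast_smul_eq_nsmul ℂ, smul_smul,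
      inv_mul_cancel₀ hNC, one_smul]
  have m1 : AEStronglyMeasurable G1 μ := (Finset.aestronglyMeasurable_sum _ fun k _ =>
    (auxT_sm _ (hf _)).aestronglyMeasurable.sub (Lp.aestronglyMeasurable h)).const_smul _
  have m2' : ∀ k, AEStronglyMeasurable (auxT M' (f (i k)) - auxT M (f (i k))) μ := fun k =>
    ((auxT_sm _ (hf _)).sub (auxT_sm _ (hf _))).aestronglyMeasurable
  have m2 : AEStronglyMeasurable G2 μ := (Finset.aestronglyMeasurable_sum _ fun k _ =>
    m2' k).const_smul _
  have m3' : ∀ k, AEStronglyMeasurable (f (i k) - auxT M' (f (i k))) μ := fun k =>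
    ((hf _).sub (auxT_sm _ (hf _))).aestronglyMeasurable
  have m3 : AEStronglyMeasurable G3 μ := (Finset.aestronglyMeasurable_sum _ fun k _ =>
    m3' k).const_smul _
  have b1 : eLpNorm G1 p μ ≤ ENNReal.ofReal η := by
    refine (eLpNorm_le_eLpNorm_of_exponent_le (hp1.le.trans one_le_two) m1).trans ?_
    set s : Lp ℂ 2 μ := ∑ k ∈ Finset.range N, ((hmem (i k)).toLp (auxT M (f (i k))) - h) with hs
    have e : eLpNorm (∑ k ∈ Finset.range N, (auxT M (f (i k)) - ⇑h)) 2 μ = ENNReal.ofReal ‖s‖ := by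
      rw [← eLpNorm_congr_ae (aux_coe_sum (fun k => auxT M (f (i k))) (fun k => hmem (i k)) h N),
        Lp.norm_def, ENNReal.ofReal_toReal (Lp.eLpNorm_ne_top _)]
    rw [hG1, eLpNorm_const_smul, e, ← ofReal_norm, ← ENNReal.ofReal_mul (norm_nonneg _)]
    refine ENNReal.ofReal_le_ofReal ?_
    rw [norm_inv, Complex.norm_natCast, inv_mul_le_iff₀ hN0']
    refine abs_le_of_sq_le_sq' ?_ (by positivity) |>.2
    refine hsum.trans ?_
    rw [div_lt_iff₀ (by positivity)] at hN
    nlinarith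
  have b2 : eLpNorm G2 p μ ≤ ENNReal.ofReal η :=
    (eLpNorm_le_eLpNorm_of_exponent_le hp1.le m2).trans (aux_avg hN0 _ m2' _ fun k => (hi k).2)
  have b3 : eLpNorm G3 p μ ≤ ENNReal.ofReal η := by
    have h1 : eLpNorm G3 1 μ ≤ 1 := aux_avg hN0 _ m3' _ fun k => by
      refine (eLpNorm_mono fun x => ?_).trans (hb (i k))
      show ‖f (i k) x - auxT M' (f (i k)) x‖ ≤ ‖f (i k) x‖
      by_cases hx : ‖f (i k) x‖ ≤ M'
      · have e1 : auxT M' (f (i k)) x = f (i k) x := Set.indicator_of_mem (by exact hx) _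
        simp [e1]
      · have e1 : auxT M' (f (i k)) x = 0 := Set.indicator_of_notMem (by exact hx) _
        simp [e1]
    let D : Set Ω := ⋃ k ∈ Finset.range N, {x | (M' : ℝ≥0∞) ≤ ‖f (i k) x‖ₑ}
    have hD : MeasurableSet D := Finset.measurableSet_biUnion _ fun k _ =>
      measurableSet_le measurable_const (hf _).enorm
    refine (aux_small hp1 G3 m3 h1 D hD ?_).trans ?_
    · intro x hx
      simp only [hG3, Pi.smul_apply, Finset.sum_apply, Pi.sub_apply]
      rw [Finset.sum_eq_zero, smul_zero]
      intro k hk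
      have hx' : ‖f (i k) x‖ₑ < M' := by
        by_contra hcon
        exact hx (Set.mem_biUnion (by exact hk) (not_lt.1 hcon))
      have hx2 : ‖f (i k) x‖ ≤ M' := by
        rw [← ofReal_norm, ← ENNReal.ofReal_natCast] at hx'
        exact ((ENNReal.ofReal_lt_ofReal_iff hM'0).1 hx').le
      have e1 : auxT M' (f (i k)) x = f (i k) x := Set.indicator_of_mem (by exact hx2) _
      simp [e1]
    · have hk : ∀ k, μ {x | (M' : ℝ≥0∞) ≤ ‖f (i k) x‖ₑ} ≤ ENNReal.ofReal (1 / M') := by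
        intro k
        have := mul_meas_ge_le_lintegral (μ := μ) (hf (i k)).enorm (M' : ℝ≥0∞)
        rw [← eLpNorm_one_eq_lintegral_enorm] at this
        have h2 := this.trans (hb (i k))
        rw [ENNReal.ofReal_div_of_pos hM'0, ENNReal.ofReal_one, ENNReal.ofReal_natCast]
        rw [ENNReal.le_div_iff_mul_le (by right; simp) (by right; simp), mul_comm]
        exact h2
      have hμD : μ D ≤ ENNReal.ofReal τ := by
        refine (measure_biUnion_finset_le _ _).trans ?_
        refine (Finset.sum_le_sum fun k _ => hk k).trans ?_
        rw [Finset.sum_const, Finset.card_range, nsmul_eq_mul, ← ENNReal.ofReal_natCast,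
          ← ENNReal.ofReal_mul hN0'.le]
        refine ENNReal.ofReal_le_ofReal ?_
        rw [mul_one_div, div_le_iff₀ hM'0]
        rw [div_lt_iff₀ hτ0] at hm
        nlinarith
      calc μ D ^ r ≤ ENNReal.ofReal τ ^ r := ENNReal.rpow_le_rpow hμD hr0.le
        _ = ENNReal.ofReal (τ ^ r) := ENNReal.ofReal_rpow_of_pos hτ0
        _ = ENNReal.ofReal η := by
          rw [hτ, ← Real.rpow_mul hη.le, one_div_mul_cancel hr0.ne', Real.rpow_one]
  rw [hdec]
  refine (eLpNorm_add_le' (m1.add m2) m3 p).trans ?_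
  gcongr
  refine (eLpNorm_add_le' m1 m2 p).trans ?_
  gcongr

/-- Let `(Ω, Σ, μ)` be a probability space and `0 < p < 1`.  Let `S` be a linear subspace of
`L^∞(μ)` (a submodule of the space of a.e.-equivalence classes consisting of essentially
bounded functions), let `S₁` be the closure of `S` in `L¹(μ)` and `Sₚ` the closure of `S` in
`Lᵖ(μ)` (closures described via sequential approximation in the corresponding
(quasi-)norms `eLpNorm · 1 μ` and `eLpNorm · p μ`).  If `E` is a Banach space and
`T̃ : Sₚ → E` is a continuous linear operator (continuity with respect to the `Lᵖ`
quasi-norm topology, expressed sequentially), then `T̃ ∘ i_{1,p} : S₁ → E` is weakly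
compact: the image under `T̃` of the closed unit ball of `S₁` (viewed inside `Sₚ` via the
natural inclusion `i_{1,p}`) is relatively compact in the weak topology of `E`. -/
theorem weaklyCompact_comp_inclusion_of_Lp_continuous
    {Ω : Type*} [MeasurableSpace Ω] {μ : Measure Ω} [IsProbabilityMeasure μ]
    {p : ℝ≥0∞} (hp0 : 0 < p) (hp1 : p < 1)
    {E : Type*} [NormedAddCommGroup E] [NormedSpace ℂ E] [CompleteSpace E]
    (S : Submodule ℂ (Ω →ₘ[μ] ℂ))
    (hS : ∀ f ∈ S, eLpNorm (f : Ω →ₘ[μ] ℂ) ∞ μ ≠ ∞)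
    (S₁ : Submodule ℂ (Ω →ₘ[μ] ℂ))
    (hS₁ : ∀ f : Ω →ₘ[μ] ℂ, f ∈ S₁ ↔
      ∃ g : ℕ → Ω →ₘ[μ] ℂ, (∀ n, g n ∈ S) ∧
        Tendsto (fun n => eLpNorm (⇑(g n - f)) 1 μ) atTop (𝓝 0))
    (Sₚ : Submodule ℂ (Ω →ₘ[μ] ℂ))
    (hSₚ : ∀ f : Ω →ₘ[μ] ℂ, f ∈ Sₚ ↔
      ∃ g : ℕ → Ω →ₘ[μ] ℂ, (∀ n, g n ∈ S) ∧
        Tendsto (fun n => eLpNorm (⇑(g n - f)) p μ) atTop (𝓝 0))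
    (T : Sₚ →ₗ[ℂ] E)
    (hTcont : ∀ (u : ℕ → Sₚ) (v : Sₚ),
      Tendsto (fun n => eLpNorm (⇑((u n : Ω →ₘ[μ] ℂ) - (v : Ω →ₘ[μ] ℂ))) p μ) atTop (𝓝 0) →
      Tendsto (fun n => T (u n)) atTop (𝓝 (T v))) :
    IsCompact (closure {y : WeakSpace ℂ E | ∃ x : Sₚ,
      (x : Ω →ₘ[μ] ℂ) ∈ S₁ ∧ eLpNorm (⇑(x : Ω →ₘ[μ] ℂ)) 1 μ ≤ 1 ∧
      y = toWeakSpace ℂ E (T x)}) := by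
  have hT : ∀ δ : ℝ, 0 < δ → ∃ ε : ℝ≥0∞, 0 < ε ∧ ∀ x : Sₚ,
      eLpNorm (⇑(x : Ω →ₘ[μ] ℂ)) p μ < ε → ‖T x‖ < δ := by
    intro δ hδ
    by_contra! hcon
    have hu : ∀ n : ℕ, ∃ x : Sₚ, eLpNorm (⇑(x : Ω →ₘ[μ] ℂ)) p μ < (n : ℝ≥0∞)⁻¹ ∧ δ ≤ ‖T x‖ :=
      fun n => hcon _ (by simp)
    choose u hu1 hu2 using hu
    have h1 := hTcont u 0 (by
      refine tendsto_of_tendsto_of_tendsto_of_le_of_le tendsto_const_nhds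
        ENNReal.tendsto_inv_nat_nhds_zero (fun _ => zero_le) (fun n => ?_)
      have := (hu1 n).le
      simpa using this)
    have h2 := h1.norm
    rw [map_zero, norm_zero] at h2
    exact absurd (ge_of_tendsto' h2 hu2) (not_le.2 hδ)
  obtain ⟨K, hK⟩ : ∃ K : ℝ, ∀ x : Sₚ, eLpNorm (⇑(x : Ω →ₘ[μ] ℂ)) 1 μ ≤ 1 → ‖T x‖ ≤ K := by
    obtain ⟨ε, hε, h⟩ := hT 1 one_pos
    obtain ⟨r, hr0, hr⟩ := ENNReal.exists_nnreal_pos_mul_lt one_ne_top hε.ne'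
    refine ⟨(r : ℝ)⁻¹, fun x hx => ?_⟩
    have hr0' : (0 : ℝ) < r := hr0
    have h1 : eLpNorm (⇑((((r : ℝ) : ℂ) • x : Sₚ) : Ω →ₘ[μ] ℂ)) p μ < ε := by
      rw [Submodule.coe_smul, eLpNorm_congr_ae (AEEqFun.coeFn_smul _ _), eLpNorm_const_smul]
      have e : ‖((r : ℝ) : ℂ)‖ₑ = (r : ℝ≥0∞) := by
        rw [← ofReal_norm]; simp
      rw [e]
      refine lt_of_le_of_lt ?_ hr
      gcongr
      exact (eLpNorm_le_eLpNorm_of_exponent_le hp1.le (AEEqFun.aestronglyMeasurable _)).trans hx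
    have h2 := h _ h1
    rw [map_smul, norm_smul, Complex.norm_real, Real.norm_of_nonneg hr0'.le] at h2
    rw [← one_div, le_div_iff₀ hr0', mul_comm]
    exact h2.le
  haveI : RegularSpace (WeakSpace ℂ E) := inferInstance
  refine aux_regular fun V hV => ?_
  set s : Set (WeakSpace ℂ E) := {y : WeakSpace ℂ E | ∃ x : Sₚ,
      (x : Ω →ₘ[μ] ℂ) ∈ S₁ ∧ eLpNorm (⇑(x : Ω →ₘ[μ] ℂ)) 1 μ ≤ 1 ∧
      y = toWeakSpace ℂ E (T x)} with hs
  have hξ : ∀ y : WeakSpace ℂ E, ∃ x : Sₚ, eLpNorm (⇑(x : Ω →ₘ[μ] ℂ)) 1 μ ≤ 1 ∧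
      (y ∈ s → y = toWeakSpace ℂ E (T x)) := by
    intro y
    by_cases hy : y ∈ s
    · obtain ⟨x, _, h1, h2⟩ := hy
      exact ⟨x, h1, fun _ => h2⟩
    · refine ⟨0, ?_, fun h => absurd h hy⟩
      rw [Submodule.coe_zero, eLpNorm_congr_ae AEEqFun.coeFn_zero]
      simp
  choose ξ hξ1 hξ2 using hξ
  have hclaim : ∀ δ : ℝ, 0 < δ → ∃ z : E, ∀ A ∈ V, ∃ N : ℕ, 0 < N ∧ ∃ i : ℕ → WeakSpace ℂ E,
      (∀ k, i k ∈ A) ∧ ‖(N : ℂ)⁻¹ • ∑ k ∈ Finset.range N, T (ξ (i k)) - z‖ < δ := by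
    intro δ hδ
    obtain ⟨ε, hε, hTε⟩ := hT δ hδ
    set c := LpAddConst p with hc
    have hct : c ≠ ∞ := (LpAddConst_lt_top p).ne
    obtain ⟨η, hη0, hη⟩ := ENNReal.exists_nnreal_pos_mul_lt
      (a := c * (c * (c * (1 + 1) + 1) + c * (c * (1 + 1) + 1))) (b := ε)
      (by finiteness) hε.ne'
    obtain ⟨h, hhm, hh⟩ := aux_key hp0 hp1 V (fun y => ⇑(ξ y : Ω →ₘ[μ] ℂ))
      (fun y => AEEqFun.stronglyMeasurable _) hξ1 (η : ℝ) hη0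
    rw [ENNReal.ofReal_coe_nnreal] at hh
    have hco : ∀ (N : ℕ) (i : ℕ → WeakSpace ℂ E),
        ⇑((((N : ℂ)⁻¹ • ∑ k ∈ Finset.range N, ξ (i k) : Sₚ)) : Ω →ₘ[μ] ℂ) =ᵐ[μ]
          (N : ℂ)⁻¹ • ∑ k ∈ Finset.range N, ⇑(ξ (i k) : Ω →ₘ[μ] ℂ) := by
      intro N i
      rw [Submodule.coe_smul]
      refine (AEEqFun.coeFn_smul _ _).trans ?_
      have : ∀ n : ℕ, ⇑((∑ k ∈ Finset.range n, ξ (i k) : Sₚ) : Ω →ₘ[μ] ℂ) =ᵐ[μ]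
          ∑ k ∈ Finset.range n, ⇑(ξ (i k) : Ω →ₘ[μ] ℂ) := by
        intro n
        induction n with
        | zero => simpa using AEEqFun.coeFn_zero
        | succ n ih =>
          rw [Finset.sum_range_succ, Finset.sum_range_succ, Submodule.coe_add]
          exact (AEEqFun.coeFn_add _ _).trans (ih.add (EventuallyEq.refl _ _))
      exact (this N).const_smul _
    obtain ⟨N₀, hN₀, i₀, -, hi₀⟩ := hh Set.univ univ_mem
    refine ⟨T ((N₀ : ℂ)⁻¹ • ∑ k ∈ Finset.range N₀, ξ (i₀ k)), fun A hA => ?_⟩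
    obtain ⟨N, hN, i, hi, hiA⟩ := hh A hA
    refine ⟨N, hN, i, hi, ?_⟩
    rw [← map_sum, ← map_smul, ← map_sub]
    refine hTε _ (lt_of_le_of_lt ?_ hη)
    rw [Submodule.coe_sub, eLpNorm_congr_ae
      ((AEEqFun.coeFn_sub _ _).trans ((hco N i).sub (hco N₀ i₀)))]
    rw [← sub_sub_sub_cancel_right _ _ h]
    have mm : ∀ (N : ℕ) (i : ℕ → WeakSpace ℂ E), AEStronglyMeasurable
        ((N : ℂ)⁻¹ • ∑ k ∈ Finset.range N, ⇑(ξ (i k) : Ω →ₘ[μ] ℂ) - h) μ := fun N i =>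
      ((Finset.aestronglyMeasurable_sum _ fun k _ =>
        AEEqFun.aestronglyMeasurable _).const_smul _).sub hhm
    refine (eLpNorm_sub_le' (mm N i) (mm N₀ i₀) p).trans ?_
    calc c * _ ≤ c * (c * (c * (η + η) + η) + c * (c * (η + η) + η)) := by
          gcongr
      _ = _ := by ring
  have hφ : ∀ φ : StrongDual ℂ E, ∃ c : ℂ, Tendsto (fun y => φ (T (ξ y))) V (𝓝 c) := by
    intro φ
    obtain ⟨c, -, hc⟩ := (isCompact_closedBall (0 : ℂ) (‖φ‖ * K)).ultrafilter_le_nhds'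
      (V.map (fun y => φ (T (ξ y)))) (by
        refine mem_map.2 (Eventually.of_forall fun y => ?_)
        have : ‖φ (T (ξ y))‖ ≤ ‖φ‖ * K := (φ.le_opNorm _).trans (by gcongr; exact hK _ (hξ1 y))
        simpa using this)
    exact ⟨c, hc⟩
  choose c hc using hφ
  have hzc : ∀ δ : ℝ, 0 < δ → ∃ z : E, ∀ φ : StrongDual ℂ E, ‖φ z - c φ‖ ≤ δ * ‖φ‖ := by
    intro δ hδ
    obtain ⟨z, hz⟩ := hclaim δ hδ
    refine ⟨z, fun φ => ?_⟩
    refine le_of_forall_pos_le_add fun η hη => ?_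
    have hA : {y | φ (T (ξ y)) ∈ Metric.closedBall (c φ) η} ∈ V :=
      (hc φ) (Metric.closedBall_mem_nhds _ hη)
    obtain ⟨N, hN, i, hi, hlt⟩ := hz _ hA
    have hNC : (N : ℂ) ≠ 0 := by exact_mod_cast hN.ne'
    have hNR : (0 : ℝ) < N := by exact_mod_cast hN
    set F := (N : ℂ)⁻¹ • ∑ k ∈ Finset.range N, T (ξ (i k)) with hF
    have h1 : ‖φ F - c φ‖ ≤ η := by
      have e : φ F - c φ = (N : ℂ)⁻¹ * ∑ k ∈ Finset.range N, (φ (T (ξ (i k))) - c φ) := by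
        rw [hF, map_smul, map_sum, Finset.sum_sub_distrib, mul_sub, smul_eq_mul]
        congr 1
        rw [Finset.sum_const, Finset.card_range, nsmul_eq_mul, ← mul_assoc,
          inv_mul_cancel₀ hNC, one_mul]
      rw [e, norm_mul, norm_inv, Complex.norm_natCast, inv_mul_le_iff₀ hNR]
      refine (norm_sum_le _ _).trans ?_
      refine (Finset.sum_le_sum (g := fun _ => η) fun k _ => ?_).trans ?_
      · have := hi k
        simpa [dist_eq_norm] using this
      · simp
    have h2 : ‖φ (F - z)‖ ≤ δ * ‖φ‖ := by
      refine (φ.le_opNorm _).trans ?_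
      rw [mul_comm]
      gcongr
    have e : φ z - c φ = (φ F - c φ) - φ (F - z) := by rw [map_sub]; ring
    rw [e]
    refine (norm_sub_le _ _).trans ?_
    linarith
  have hz' : ∀ n : ℕ, ∃ z : E, ∀ φ : StrongDual ℂ E, ‖φ z - c φ‖ ≤ (1 / ((n : ℝ) + 1)) * ‖φ‖ :=
    fun n => hzc _ (by positivity)
  choose z hz using hz'
  have hlim0 : Tendsto (fun n : ℕ => 1 / ((n : ℝ) + 1)) atTop (𝓝 0) :=
    tendsto_one_div_add_atTop_nhds_zero_nat
  have hcau : CauchySeq z := by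
    refine cauchySeq_of_le_tendsto_0 (fun n : ℕ => 2 * (1 / ((n : ℝ) + 1))) ?_
      (by simpa using hlim0.const_mul 2)
    intro n m k hn hm
    rw [dist_eq_norm]
    refine NormedSpace.norm_le_dual_bound ℂ _ (by positivity) fun φ => ?_
    have e : φ (z n - z m) = (φ (z n) - c φ) - (φ (z m) - c φ) := by rw [map_sub]; ring
    rw [e]
    refine (norm_sub_le _ _).trans ?_
    have a1 : 1 / ((n : ℝ) + 1) ≤ 1 / ((k : ℝ) + 1) := by gcongr
    have a2 : 1 / ((m : ℝ) + 1) ≤ 1 / ((k : ℝ) + 1) := by gcongr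
    have b1 := mul_le_mul_of_nonneg_right a1 (norm_nonneg φ)
    have b2 := mul_le_mul_of_nonneg_right a2 (norm_nonneg φ)
    linarith [hz n φ, hz m φ]
  obtain ⟨w, hw⟩ := cauchySeq_tendsto_of_complete hcau
  have hwc : ∀ φ : StrongDual ℂ E, φ w = c φ := by
    intro φ
    have h1 : Tendsto (fun n => φ (z n)) atTop (𝓝 (φ w)) := (φ.continuous.tendsto w).comp hw
    have h2 : Tendsto (fun n => φ (z n)) atTop (𝓝 (c φ)) := by
      rw [tendsto_iff_norm_sub_tendsto_zero]
      refine squeeze_zero (fun _ => norm_nonneg _) (fun n => hz n φ) ?_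
      simpa using hlim0.mul_const ‖φ‖
    exact tendsto_nhds_unique h1 h2
  refine ⟨toWeakSpace ℂ E w, ?_⟩
  have hind : Topology.IsInducing
      (fun (x : WeakSpace ℂ E) (φ : StrongDual ℂ E) => (topDualPairing ℂ E).flip x φ) := ⟨rfl⟩
  have hT2 : Tendsto (fun y : WeakSpace ℂ E => y) V (𝓝 (toWeakSpace ℂ E w)) := by
    rw [hind.tendsto_nhds_iff, tendsto_pi_nhds]
    intro φ
    have h1 : Tendsto (fun y => φ (T (ξ y))) V (𝓝 (φ w)) := by rw [hwc]; exact hc φ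
    refine Tendsto.congr' ?_ h1
    filter_upwards [hV] with y hy
    have := hξ2 y hy
    conv_rhs => rw [this]
    rfl
  exact hT2
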